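/- arXiv:1409.4494 — 2 statements merged into one kernel-verified Lean document; each statement's English description precedes it below -/
import Mathlib

section
/- For every k ≥ 1 and all tuples p = (p(1),…,p(k)), q = (q(1),…,q(k)) of nonnegative integers, the mixed matrix moments of the complex Ginibre ensemble converge: lim_{n→∞} m_n(p,q) = m(p,q), where m(p,q) is the number of non-crossing perfect matchings of the R = p(1)+⋯+p(k)+q(1)+⋯+q(k) cyclically ordered vertices carrying the spin sequence σ = ((+1)^{p(1)}, (−1)^{q(1)}, …, (+1)^{p(k)}, (−1)^{q(k)}) in which every matched pair consists of one vertex with spin +1 and one vertex with spin −1. (In particular the limit is 0 when p(1)+⋯+p(k) ≠ q(1)+⋯+q(k).) -/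
open MeasureTheory ProbabilityTheory Matrix

/-- The complex Ginibre matrix of size `n` built from i.i.d. standard Gaussian
real and imaginary parts: `a_n(j,k) = (X(j,k) + iY(j,k))/√(2n)`. -/
noncomputable def ginibreMatrix (n : ℕ)
    (ω : ((Fin n × Fin n) → ℝ) × ((Fin n × Fin n) → ℝ)) :
    Matrix (Fin n) (Fin n) ℂ :=
  fun j k => ((ω.1 (j, k) : ℂ) + (ω.2 (j, k) : ℂ) * Complex.I) /
    (Real.sqrt (2 * n) : ℂ)

/-- The law of the Gaussian data of the complex Ginibre ensemble: all real and
imaginary parts are i.i.d. standard Gaussians. -/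
noncomputable def ginibreMeasure (n : ℕ) :
    Measure (((Fin n × Fin n) → ℝ) × ((Fin n × Fin n) → ℝ)) :=
  (Measure.pi fun _ : Fin n × Fin n => gaussianReal 0 1).prod
    (Measure.pi fun _ : Fin n × Fin n => gaussianReal 0 1)

/-- The mixed matrix moment
`m_n(p,q) = E[(1/n) tr(A^{p(1)} (A^*)^{q(1)} ⋯ A^{p(k)} (A^*)^{q(k)})]`
of the complex Ginibre ensemble. -/
noncomputable def ginibreMixedMoment (n k : ℕ) (p q : Fin k → ℕ) : ℂ :=
  ∫ ω, (n : ℂ)⁻¹ * Matrix.trace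
      ((List.ofFn fun i : Fin k =>
        (ginibreMatrix n ω) ^ (p i) * ((ginibreMatrix n ω)ᴴ) ^ (q i)).prod)
    ∂(ginibreMeasure n)

/-- The spin sequence `σ = ((+1)^{p(1)}, (-1)^{q(1)}, …, (+1)^{p(k)}, (-1)^{q(k)})`,
encoded as a list of booleans (`true` for `+1`, `false` for `-1`). -/
def spinList (k : ℕ) (p q : Fin k → ℕ) : List Bool :=
  (List.ofFn fun i : Fin k =>
    List.replicate (p i) true ++ List.replicate (q i) false).flatten

/-- `f` is (the pairing involution of) a non-crossing perfect matching of the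
positions of `s`, in which every matched pair carries one `+1` spin (`true`)
and one `-1` spin (`false`). -/
def IsNoncrossingSpinMatching (s : List Bool) (f : Fin s.length → Fin s.length) :
    Prop :=
  (∀ x, f (f x) = x) ∧ (∀ x, f x ≠ x) ∧
  (∀ a b c d : Fin s.length, a < b → b < c → c < d → ¬(f a = c ∧ f b = d)) ∧
  (∀ x, s.get (f x) = ! s.get x)

/-- The number of non-crossing perfect matchings of the spin sequence in which
every matched pair consists of one `+1` and one `-1` spin. -/
noncomputable def matchingCount (s : List Bool) : ℕ :=
  Nat.card {f : Fin s.length → Fin s.length // IsNoncrossingSpinMatching s f}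


theorem integrable_pow_gaussianReal (k : ℕ) :
    Integrable (fun x : ℝ => x ^ k) (gaussianReal 0 1) := by
  have h := (memLp_id_gaussianReal' (μ := 0) (v := 1) (k : ENNReal) (by simp)).integrable_norm_pow'
  exact h.mono' (by fun_prop) (by simp)

theorem integral_pow_succ_gaussianReal (k : ℕ) :
    ∫ x : ℝ, x ^ (k + 1) ∂(gaussianReal 0 1) = k * ∫ x : ℝ, x ^ (k - 1) ∂(gaussianReal 0 1) := by
  have hpow : ∀ m : ℕ, Integrable (fun x : ℝ => gaussianPDFReal 0 1 x * x ^ m) := by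
    intro m
    have h := integrable_pow_gaussianReal m
    rw [gaussianReal_of_var_ne_zero 0 one_ne_zero,
      integrable_withDensity_iff_integrable_smul₀' (by fun_prop)
        (by simp [gaussianPDF])] at h
    simpa [gaussianPDF, gaussianPDFReal_nonneg] using h
  have hderiv : ∀ x : ℝ, HasDerivAt (fun x : ℝ => gaussianPDFReal 0 1 x * x ^ k)
      (k * (gaussianPDFReal 0 1 x * x ^ (k - 1)) - gaussianPDFReal 0 1 x * x ^ (k + 1)) x := by
    intro x
    have h1 : HasDerivAt (gaussianPDFReal 0 1) (-x * gaussianPDFReal 0 1 x) x := by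
      have h2 : HasDerivAt (fun x : ℝ => -x ^ 2 / 2) (-x) x := by
        convert! ((hasDerivAt_pow 2 x).neg.div_const 2) using 1
        simp
        ring
      have h3 := (h2.exp).const_mul (Real.sqrt (2 * Real.pi))⁻¹
      have h4 : gaussianPDFReal 0 1 = fun x => (Real.sqrt (2 * Real.pi))⁻¹ * Real.exp (-x ^ 2 / 2) := by
        ext y; simp [gaussianPDFReal]
      rw [h4]
      convert! h3 using 1
      ring
    convert! h1.mul (hasDerivAt_pow k x) using 1
    ring
  have h0 := integral_eq_zero_of_hasDerivAt_of_integrable hderiv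
    (((hpow (k - 1)).const_mul _).sub (hpow (k + 1))) (hpow k)
  rw [integral_sub ((hpow (k - 1)).const_mul _) (hpow (k + 1)), integral_const_mul] at h0
  simp only [integral_gaussianReal_eq_integral_smul one_ne_zero, smul_eq_mul]
  linarith

theorem integral_complex_pow_gaussianReal (k : ℕ) :
    ∫ x : ℝ, (x : ℂ) ^ (k + 1) ∂(gaussianReal 0 1)
      = k * ∫ x : ℝ, (x : ℂ) ^ (k - 1) ∂(gaussianReal 0 1) := by
  have h : ∀ m : ℕ, ∫ x : ℝ, (x : ℂ) ^ m ∂(gaussianReal 0 1)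
      = ((∫ x : ℝ, x ^ m ∂(gaussianReal 0 1) : ℝ) : ℂ) := by
    intro m
    rw [← integral_complex_ofReal]
    simp
  rw [h, h, integral_pow_succ_gaussianReal]
  simp

section GaussianExpectation

variable {σ : Type*} [Fintype σ]

/-- Evaluation of a polynomial in two families of variables at a pair of real points. -/
noncomputable def pairEval (ω : (σ → ℝ) × (σ → ℝ)) : MvPolynomial (σ ⊕ σ) ℂ →ₐ[ℂ] ℂ :=
  MvPolynomial.aeval fun v => ((Sum.elim ω.1 ω.2 v : ℝ) : ℂ)

/-- The standard Gaussian measure on pairs of real points. -/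
noncomputable def gaussianPair (σ : Type*) [Fintype σ] : Measure ((σ → ℝ) × (σ → ℝ)) :=
  (Measure.pi fun _ : σ => gaussianReal 0 1).prod (Measure.pi fun _ : σ => gaussianReal 0 1)

theorem pairEval_monomial (ω : (σ → ℝ) × (σ → ℝ)) (m : (σ ⊕ σ) →₀ ℕ) (a : ℂ) :
    pairEval ω (MvPolynomial.monomial m a)
      = a * ((∏ v, (ω.1 v : ℂ) ^ m (Sum.inl v)) * ∏ v, (ω.2 v : ℂ) ^ m (Sum.inr v)) := by
  rw [pairEval, MvPolynomial.aeval_monomial, Finsupp.prod_fintype _ _ (by simp),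
    Fintype.prod_sum_type]
  simp

theorem integrable_complex_pow_gaussianReal (k : ℕ) :
    Integrable (fun x : ℝ => (x : ℂ) ^ k) (gaussianReal 0 1) := by
  simpa using (integrable_pow_gaussianReal k).ofReal (𝕜 := ℂ)

theorem integrable_pairEval (p : MvPolynomial (σ ⊕ σ) ℂ) :
    Integrable (fun ω => pairEval ω p) (gaussianPair σ) := by
  induction p using MvPolynomial.induction_on' with
  | add p q hp hq =>
    simp only [map_add]
    exact hp.add hq
  | monomial m a =>
    simp only [pairEval_monomial]
    have h : ∀ e : σ → ℕ, Integrable (fun x : σ → ℝ => ∏ v, (x v : ℂ) ^ e v)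
        (Measure.pi fun _ : σ => gaussianReal 0 1) := fun e =>
      Integrable.fintype_prod (f := fun v (x : ℝ) => (x : ℂ) ^ e v)
        fun v => integrable_complex_pow_gaussianReal _
    exact Integrable.const_mul ((h fun v => m (Sum.inl v)).mul_prod (h fun v => m (Sum.inr v))) a

/-- The expectation of a polynomial in independent standard Gaussian variables. -/
noncomputable def gaussianExpect (σ : Type*) [Fintype σ] : MvPolynomial (σ ⊕ σ) ℂ →ₗ[ℂ] ℂ where
  toFun p := ∫ ω, pairEval ω p ∂(gaussianPair σ)
  map_add' p q := by
    simp only [map_add]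
    exact integral_add (integrable_pairEval p) (integrable_pairEval q)
  map_smul' c p := by
    simp only [map_smul, smul_eq_mul, RingHom.id_apply]
    exact integral_const_mul _ _

theorem gaussianExpect_monomial (m : (σ ⊕ σ) →₀ ℕ) (a : ℂ) :
    gaussianExpect σ (MvPolynomial.monomial m a)
      = a * ∏ v, ∫ x : ℝ, (x : ℂ) ^ m v ∂(gaussianReal 0 1) := by
  change ∫ ω, pairEval ω _ ∂(gaussianPair σ) = _
  simp only [pairEval_monomial]
  rw [integral_const_mul, gaussianPair,
    integral_prod_mul (fun x : σ → ℝ => ∏ v, (x v : ℂ) ^ m (Sum.inl v))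
      (fun x : σ → ℝ => ∏ v, (x v : ℂ) ^ m (Sum.inr v)),
    integral_fintype_prod_eq_prod (fun v (x : ℝ) => (x : ℂ) ^ m (Sum.inl v)),
    integral_fintype_prod_eq_prod (fun v (x : ℝ) => (x : ℂ) ^ m (Sum.inr v)),
    Fintype.prod_sum_type]

theorem gaussianExpect_one : gaussianExpect σ 1 = 1 := by
  have h := gaussianExpect_monomial (σ := σ) 0 1
  simpa using h

/-- Gaussian integration by parts. -/
theorem gaussianExpect_X_mul (v : σ ⊕ σ) (p : MvPolynomial (σ ⊕ σ) ℂ) :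
    gaussianExpect σ (MvPolynomial.X v * p) = gaussianExpect σ (MvPolynomial.pderiv v p) := by
  classical
  induction p using MvPolynomial.induction_on' with
  | add p q hp hq => simp only [mul_add, map_add, hp, hq]
  | monomial m a =>
    rw [MvPolynomial.X, MvPolynomial.monomial_mul, MvPolynomial.pderiv_monomial,
      gaussianExpect_monomial, gaussianExpect_monomial,
      ← Finset.mul_prod_erase _ _ (Finset.mem_univ v),
      ← Finset.mul_prod_erase _ _ (Finset.mem_univ v)]
    have h1 : ∏ x ∈ Finset.univ.erase v,
        ∫ y : ℝ, (y : ℂ) ^ (Finsupp.single v 1 + m : (σ ⊕ σ) →₀ ℕ) x ∂(gaussianReal 0 1)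
        = ∏ x ∈ Finset.univ.erase v,
        ∫ y : ℝ, (y : ℂ) ^ (m - Finsupp.single v 1 : (σ ⊕ σ) →₀ ℕ) x ∂(gaussianReal 0 1) := by
      refine Finset.prod_congr rfl fun x hx => ?_
      have hx : v ≠ x := (Finset.ne_of_mem_erase hx).symm
      simp [hx]
    rw [h1]
    simp only [Finsupp.add_apply, Finsupp.single_eq_same, Finsupp.tsub_apply]
    rw [add_comm 1, integral_complex_pow_gaussianReal]
    ring

end GaussianExpectation

section SchwingerDyson

theorem sum_list_sum_comm {ι α R : Type*} [AddCommMonoid R] (t : Finset ι) (l : List α)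
    (f : ι → α → R) :
    ∑ i ∈ t, (l.map (f i)).sum = (l.map fun a => ∑ i ∈ t, f i a).sum := by
  induction l with
  | nil => simp
  | cons a l ih => simp [Finset.sum_add_distrib, ih]

theorem list_sum_congr {α R : Type*} [AddMonoid R] {l : List α} {f g : α → R}
    (h : ∀ a ∈ l, f a = g a) : (l.map f).sum = (l.map g).sum :=
  congrArg List.sum (List.map_congr_left h)

/-- All ways to write the word `s` as `u ++ b :: v`, as a list of pairs `(u, v)`. -/
def letterCuts (b : Bool) : List Bool → List (List Bool × List Bool)
  | [] => []
  | c :: s => (if c = b then [([], s)] else []) ++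
      (letterCuts b s).map fun uv => (c :: uv.1, uv.2)

/-- All ways to cut a letter `!b` out of one of the cyclic words in `S` and to splice `w`
into the gap. -/
def cyclicSplices (b : Bool) (w : List Bool) : List (List Bool) → List (List (List Bool))
  | [] => []
  | s :: S => ((letterCuts (!b) s).map fun uv => (w ++ uv.2 ++ uv.1) :: S) ++
      (cyclicSplices b w S).map fun S' => s :: S'

/-- The indices of the real (or imaginary) parts of the entries of an `n × n` matrix. -/
abbrev EntryIndex (n : ℕ) : Type := Fin n × Fin n

/-- Polynomials in the real and imaginary parts of the entries of an `n × n` matrix. -/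
abbrev EntryPoly (n : ℕ) : Type := MvPolynomial (EntryIndex n ⊕ EntryIndex n) ℂ

/-- The position in the Ginibre matrix giving the entry `(j, k)` of the matrix (`b = true`) or
of its adjoint (`b = false`). -/
def spinIndex {n : ℕ} (b : Bool) (j k : Fin n) : EntryIndex n := if b then (j, k) else (k, j)

/-- The imaginary unit or its conjugate. -/
noncomputable def spinUnit (b : Bool) : ℂ := if b then Complex.I else -Complex.I

/-- The scale `1/√(2n)` of the Ginibre entries. -/
noncomputable def ginibreScale (n : ℕ) : ℂ := (Real.sqrt (2 * n) : ℂ)⁻¹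

theorem two_mul_ginibreScale_sq (n : ℕ) : ginibreScale n * ginibreScale n * 2 = (n : ℂ)⁻¹ := by
  rw [ginibreScale, ← mul_inv, ← Complex.ofReal_mul, Real.mul_self_sqrt (by positivity)]
  push_cast
  rw [mul_inv]
  ring

/-- The generic matrix (`b = true`) or its adjoint (`b = false`), with polynomial entries. -/
noncomputable def letterMatrix (n : ℕ) (b : Bool) : Matrix (Fin n) (Fin n) (EntryPoly n) :=
  fun j k => ginibreScale n • (MvPolynomial.X (Sum.inl (spinIndex b j k)) +
    spinUnit b • MvPolynomial.X (Sum.inr (spinIndex b j k)))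

/-- The derivation dual to the entry `(j, k)` of `letterMatrix n b` under the Gaussian law. -/
noncomputable def entryDerivation (n : ℕ) (b : Bool) (j k : Fin n) :
    Derivation ℂ (EntryPoly n) (EntryPoly n) :=
  ginibreScale n • (MvPolynomial.pderiv (Sum.inl (spinIndex b j k)) +
    spinUnit b • MvPolynomial.pderiv (Sum.inr (spinIndex b j k)))

theorem gaussianExpect_letterMatrix_mul (n : ℕ) (b : Bool) (j k : Fin n) (p : EntryPoly n) :
    gaussianExpect (EntryIndex n) (letterMatrix n b j k * p)
      = gaussianExpect (EntryIndex n) (entryDerivation n b j k p) := by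
  simp only [letterMatrix, entryDerivation, smul_mul_assoc, add_mul, map_smul, map_add,
    gaussianExpect_X_mul, Derivation.smul_apply, Derivation.add_apply]

theorem entryDerivation_letterMatrix (n : ℕ) (b c : Bool) (j k x y : Fin n) :
    entryDerivation n b j k (letterMatrix n c x y)
      = if c = !b ∧ x = k ∧ j = y then MvPolynomial.C (n : ℂ)⁻¹ else 0 := by
  have hI : Complex.I * Complex.I = -1 := Complex.I_mul_I
  have key : entryDerivation n b j k (letterMatrix n c x y)
      = if spinIndex c x y = spinIndex b j k then
        MvPolynomial.C (ginibreScale n * ginibreScale n * (1 + spinUnit b * spinUnit c)) else 0 := by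
    simp only [letterMatrix, entryDerivation, Derivation.map_smul, Derivation.map_add, Derivation.smul_apply,
      Derivation.add_apply, MvPolynomial.pderiv_X, Pi.single_apply, Sum.inl.injEq, Sum.inr.injEq,
      reduceCtorEq, if_false]
    split_ifs with h
    · simp only [MvPolynomial.smul_eq_C_mul, map_mul, map_add, map_one]
      ring
    · simp
  rw [key, ← two_mul_ginibreScale_sq]
  cases b <;> cases c <;> simp [spinIndex, spinUnit, hI, and_comm, eq_comm, one_add_one_eq_two]

/-- The product of the generic matrices and adjoints spelled by `s`. -/
noncomputable def wordMatrix (n : ℕ) (s : List Bool) : Matrix (Fin n) (Fin n) (EntryPoly n) :=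
  (s.map (letterMatrix n)).prod

theorem wordMatrix_nil (n : ℕ) : wordMatrix n [] = 1 := rfl

theorem wordMatrix_cons (n : ℕ) (b : Bool) (s : List Bool) :
    wordMatrix n (b :: s) = letterMatrix n b * wordMatrix n s := by
  simp [wordMatrix]

theorem wordMatrix_append (n : ℕ) (s t : List Bool) :
    wordMatrix n (s ++ t) = wordMatrix n s * wordMatrix n t := by
  simp [wordMatrix]

theorem entryDerivation_wordMatrix (n : ℕ) (b : Bool) (j k x y : Fin n) (s : List Bool) :
    entryDerivation n b j k (wordMatrix n s x y)
      = ((letterCuts (!b) s).map fun uv =>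
          MvPolynomial.C (n : ℂ)⁻¹ * (wordMatrix n uv.1 x k * wordMatrix n uv.2 j y)).sum := by
  induction s generalizing x with
  | nil =>
    rw [wordMatrix_nil, Matrix.one_apply]
    split_ifs <;> simp [letterCuts]
  | cons c s ih =>
    rw [wordMatrix_cons, Matrix.mul_apply, map_sum]
    simp only [Derivation.leibniz, smul_eq_mul, entryDerivation_letterMatrix, ih, letterCuts,
      List.map_append, List.sum_append, List.map_map, Finset.sum_add_distrib]
    rw [add_comm]
    refine congrArg₂ (· + ·) ?_ ?_
    · by_cases hc : c = !b
      · by_cases hx : x = k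
        · subst hx
          simp [hc, wordMatrix_nil, mul_comm]
        · simp [hc, hx, wordMatrix_nil]
      · simp [hc]
    · simp only [Function.comp_def, wordMatrix_cons, Matrix.mul_apply, ← List.sum_map_mul_left]
      rw [sum_list_sum_comm]
      refine list_sum_congr fun uv _ => ?_
      rw [Finset.sum_mul, Finset.mul_sum]
      exact Finset.sum_congr rfl fun i _ => by ring

/-- The normalized trace of a word in the generic matrix and its adjoint. -/
noncomputable def wordTrace (n : ℕ) (s : List Bool) : EntryPoly n :=
  MvPolynomial.C (n : ℂ)⁻¹ * (wordMatrix n s).trace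

/-- The product of the normalized traces of a list of words. -/
noncomputable def wordTraceProd (n : ℕ) (S : List (List Bool)) : EntryPoly n :=
  (S.map (wordTrace n)).prod

theorem wordTraceProd_cons (n : ℕ) (s : List Bool) (S : List (List Bool)) :
    wordTraceProd n (s :: S) = wordTrace n s * wordTraceProd n S := by
  simp [wordTraceProd]

theorem entryDerivation_wordTrace (n : ℕ) (b : Bool) (j k : Fin n) (s : List Bool) :
    entryDerivation n b j k (wordTrace n s)
      = ((letterCuts (!b) s).map fun uv => MvPolynomial.C (n : ℂ)⁻¹ * (MvPolynomial.C (n : ℂ)⁻¹ *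
          wordMatrix n (uv.2 ++ uv.1) j k)).sum := by
  rw [wordTrace, ← MvPolynomial.smul_eq_C_mul, Derivation.map_smul, Matrix.trace, map_sum,
    MvPolynomial.smul_eq_C_mul]
  simp only [Matrix.diag_apply, entryDerivation_wordMatrix, wordMatrix_append, Matrix.mul_apply]
  rw [sum_list_sum_comm, ← MvPolynomial.smul_eq_C_mul, List.smul_sum, List.map_map]
  refine list_sum_congr fun uv _ => ?_
  simp only [Function.comp_apply, MvPolynomial.smul_eq_C_mul, Finset.mul_sum]
  exact Finset.sum_congr rfl fun i _ => by ring

theorem sum_wordMatrix_mul_entryDerivation (n : ℕ) (b : Bool) (w : List Bool)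
    (S : List (List Bool)) :
    ∑ j, ∑ k, wordMatrix n w k j * entryDerivation n b j k (wordTraceProd n S)
      = ((cyclicSplices b w S).map fun S' =>
          MvPolynomial.C (n : ℂ)⁻¹ * wordTraceProd n S').sum := by
  induction S with
  | nil => simp [wordTraceProd, cyclicSplices]
  | cons s S ih =>
    have h1 : ∑ j, ∑ k, wordMatrix n w k j * entryDerivation n b j k (wordTrace n s)
        = ((letterCuts (!b) s).map fun uv =>
            MvPolynomial.C (n : ℂ)⁻¹ * wordTrace n (w ++ uv.2 ++ uv.1)).sum := by
      simp only [entryDerivation_wordTrace]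
      simp only [← List.sum_map_mul_left, sum_list_sum_comm]
      refine list_sum_congr fun uv _ => ?_
      rw [wordTrace, List.append_assoc, wordMatrix_append n w, Matrix.trace_mul_comm, Matrix.trace]
      simp only [Matrix.diag_apply, Matrix.mul_apply, Finset.mul_sum]
      exact Finset.sum_congr rfl fun j _ => Finset.sum_congr rfl fun k _ => by ring
    simp only [wordTraceProd_cons, Derivation.leibniz, smul_eq_mul, mul_add,
      Finset.sum_add_distrib, cyclicSplices, List.map_append, List.sum_append, List.map_map,
      Function.comp_def]
    have h2 : ∑ j, ∑ k, wordMatrix n w k j *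
        (wordTrace n s * entryDerivation n b j k (wordTraceProd n S))
        = wordTrace n s * ∑ j, ∑ k, wordMatrix n w k j *
          entryDerivation n b j k (wordTraceProd n S) := by
      simp only [Finset.mul_sum]
      exact Finset.sum_congr rfl fun j _ => Finset.sum_congr rfl fun k _ => by ring
    have h3 : ∑ j, ∑ k, wordMatrix n w k j *
        (wordTraceProd n S * entryDerivation n b j k (wordTrace n s))
        = wordTraceProd n S * ∑ j, ∑ k, wordMatrix n w k j *
          entryDerivation n b j k (wordTrace n s) := by
      simp only [Finset.mul_sum]
      exact Finset.sum_congr rfl fun j _ => Finset.sum_congr rfl fun k _ => by ring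
    rw [h2, h3, h1, ih, add_comm, ← List.sum_map_mul_left, ← List.sum_map_mul_left]
    exact congrArg₂ (· + ·) (list_sum_congr fun _ _ => by ring)
      (list_sum_congr fun _ _ => by ring)

/-- The Schwinger–Dyson equation for products of traces of Ginibre words. -/
theorem gaussianExpect_wordTraceProd_cons {n : ℕ} (hn : (n : ℂ) ≠ 0) (b : Bool) (w : List Bool)
    (S : List (List Bool)) :
    gaussianExpect (EntryIndex n) (wordTraceProd n ((b :: w) :: S))
      = ((letterCuts (!b) w).map fun uv =>
          gaussianExpect (EntryIndex n) (wordTraceProd n (uv.1 :: uv.2 :: S))).sum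
        + (n : ℂ)⁻¹ * ((n : ℂ)⁻¹ * ((cyclicSplices b w S).map fun S' =>
          gaussianExpect (EntryIndex n) (wordTraceProd n S')).sum) := by
  have h1 : wordTraceProd n ((b :: w) :: S) = (n : ℂ)⁻¹ • ∑ j, ∑ k,
      letterMatrix n b j k * (wordMatrix n w k j * wordTraceProd n S) := by
    rw [wordTraceProd_cons, wordTrace, wordMatrix_cons, Matrix.trace, MvPolynomial.smul_eq_C_mul]
    simp only [Matrix.diag_apply, Matrix.mul_apply, Finset.mul_sum, Finset.sum_mul]
    exact Finset.sum_congr rfl fun j _ => Finset.sum_congr rfl fun k _ => by ring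
  have h2 : ∑ j, ∑ k, entryDerivation n b j k (wordMatrix n w k j * wordTraceProd n S)
      = ((letterCuts (!b) w).map fun uv => (n : ℂ) •
          wordTraceProd n (uv.1 :: uv.2 :: S)).sum + ((cyclicSplices b w S).map fun S' =>
          (n : ℂ)⁻¹ • wordTraceProd n S').sum := by
    simp only [MvPolynomial.smul_eq_C_mul]
    rw [← sum_wordMatrix_mul_entryDerivation]
    simp only [Derivation.leibniz, smul_eq_mul, Finset.sum_add_distrib,
      entryDerivation_wordMatrix]
    rw [add_comm]
    refine congrArg (· + _) ?_
    simp only [← List.sum_map_mul_left, sum_list_sum_comm]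
    refine list_sum_congr fun uv _ => ?_
    have hC : (MvPolynomial.C (n : ℂ) * (MvPolynomial.C (n : ℂ)⁻¹ * MvPolynomial.C (n : ℂ)⁻¹) :
        EntryPoly n) = MvPolynomial.C (n : ℂ)⁻¹ := by
      rw [← map_mul, ← map_mul, mul_inv_cancel_left₀ hn]
    calc _ = MvPolynomial.C (n : ℂ)⁻¹ * ((wordMatrix n uv.1).trace * (wordMatrix n uv.2).trace *
          wordTraceProd n S) := by
          rw [Matrix.trace, Matrix.trace, Finset.sum_mul_sum, Finset.sum_comm]
          simp only [Matrix.diag_apply, Finset.mul_sum, Finset.sum_mul]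
          exact Finset.sum_congr rfl fun j _ => Finset.sum_congr rfl fun k _ => by ring
      _ = _ := by
          rw [← hC, wordTraceProd_cons, wordTraceProd_cons, wordTrace, wordTrace]
          ring
  rw [h1, map_smul, map_sum]
  simp only [map_sum, gaussianExpect_letterMatrix_mul]
  simp only [← map_sum]
  rw [h2, map_add, map_list_sum, map_list_sum, List.map_map, List.map_map]
  simp only [Function.comp_def, map_smul, smul_eq_mul, List.sum_map_mul_left, mul_add]
  rw [inv_mul_cancel_left₀ hn]

end SchwingerDyson

section NoncrossingRecursion

/-- `f` is a non-crossing matching of `{0, …, n - 1}` whose pairs carry opposite spins `σ`,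
extended by the identity to all natural numbers. -/
def IsNoncrossingOn (n : ℕ) (σ : ℕ → Bool) (f : ℕ → ℕ) : Prop :=
  (∀ x, n ≤ x → f x = x) ∧
  (∀ x, x < n → f x < n ∧ f (f x) = x ∧ f x ≠ x ∧ σ (f x) = !σ x) ∧
  ∀ a b, a < b → b < f a → f b ≤ f a

/-- The number of non-crossing matchings of `{0, …, n - 1}` with opposite spins. -/
noncomputable def noncrossingCount (n : ℕ) (σ : ℕ → Bool) : ℕ :=
  Nat.card {f : ℕ → ℕ // IsNoncrossingOn n σ f}

theorem noncrossingCount_congr {n : ℕ} {σ τ : ℕ → Bool} (h : ∀ x < n, σ x = τ x) :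
    noncrossingCount n σ = noncrossingCount n τ := by
  have key : ∀ f, IsNoncrossingOn n σ f ↔ IsNoncrossingOn n τ f := by
    intro f
    refine and_congr_right fun _ => and_congr_left fun _ => forall₂_congr fun x hx => ?_
    refine and_congr_right fun hfx => ?_
    rw [h x hx, h _ hfx]
  simp only [noncrossingCount, key]

instance finite_isNoncrossingOn (n : ℕ) (σ : ℕ → Bool) :
    Finite {f : ℕ → ℕ // IsNoncrossingOn n σ f} := by
  refine Finite.of_injective
    (fun f (x : Fin n) => (⟨f.1 x, (f.2.2.1 x x.2).1⟩ : Fin n)) fun f g hfg => ?_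
  refine Subtype.ext (funext fun x => ?_)
  by_cases hx : x < n
  · simpa using congrFun hfg ⟨x, hx⟩
  · rw [f.2.1 x (by omega), g.2.1 x (by omega)]

theorem matchingCount_eq_noncrossingCount (s : List Bool) :
    matchingCount s = noncrossingCount s.length fun x => s.getD x true := by
  refine Nat.card_congr
    { toFun := fun f => ⟨fun x => if h : x < s.length then f.1 ⟨x, h⟩ else x, ?_, ?_, ?_⟩
      invFun := fun g => ⟨fun x => ⟨g.1 x, (g.2.2.1 x x.2).1⟩, ?_, ?_, ?_, ?_⟩
      left_inv := ?_
      right_inv := ?_ }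
  · intro x hx
    simp [Nat.not_lt.2 hx]
  · intro x hx
    obtain ⟨f, h1, h2, h3, h4⟩ := f
    have h2 := h2 ⟨x, hx⟩
    have h4 := h4 ⟨x, hx⟩
    simp only [ne_eq, Fin.ext_iff, List.get_eq_getElem] at h2 h4
    simp [hx, h1, h2, h4]
  · intro a b hab hb
    obtain ⟨f, h1, h2, h3, h4⟩ := f
    by_contra! hlt
    by_cases ha : a < s.length
    · by_cases hb' : b < s.length
      · simp only [ha, hb', dif_pos] at hb hlt
        exact h3 ⟨a, ha⟩ ⟨b, hb'⟩ _ _ hab hb hlt ⟨rfl, rfl⟩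
      · simp only [ha, hb', dif_pos, dif_neg, not_false_eq_true] at hb hlt
        have := (f ⟨a, ha⟩).2
        omega
    · simp only [ha, dif_neg, not_false_eq_true] at hb
      omega
  · intro x
    exact Fin.ext (g.2.2.1 x x.2).2.1
  · intro x h
    exact (g.2.2.1 x x.2).2.2.1 (congrArg Fin.val h)
  · rintro a b c d hab hbc hcd ⟨h1, h2⟩
    have h1 : g.1 a = c := congrArg Fin.val h1
    have h2 : g.1 b = d := congrArg Fin.val h2
    have := g.2.2.2 a b hab (h1 ▸ hbc)
    rw [h1, h2] at this
    exact absurd hcd (not_lt.2 this)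
  · intro x
    have h := (g.2.2.1 x x.2).2.2.2
    have h0 := (g.2.2.1 x x.2).1
    simpa [List.getD_eq_getElem, h0] using h
  · intro f
    ext x
    simp
  · intro g
    refine Subtype.ext (funext fun x => ?_)
    by_cases hx : x < s.length
    · simp [hx]
    · simp [hx, g.2.1 x (by omega)]

theorem IsNoncrossingOn.lt_of_lt {n i : ℕ} {σ : ℕ → Bool} {f : ℕ → ℕ}
    (hf : IsNoncrossingOn n σ f) (hi : i + 1 < n) (h0 : f 0 = i + 1) {x : ℕ} (hx : x < i) :
    0 < f (x + 1) ∧ f (x + 1) ≤ i := by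
  obtain ⟨-, h2, h3⟩ := hf
  have ha := h3 0 (x + 1) (by omega) (by omega)
  have hb := h2 (x + 1) (by omega)
  have hc := h2 0 (by omega)
  have hd : f (x + 1) ≠ 0 := fun h => by rw [h] at hb; omega
  have he : f (x + 1) ≠ i + 1 := fun h => by
    rw [h, ← h0, hc.2.1] at hb
    omega
  omega

theorem IsNoncrossingOn.le_of_le {n i : ℕ} {σ : ℕ → Bool} {f : ℕ → ℕ}
    (hf : IsNoncrossingOn n σ f) (hi : i + 1 < n) (h0 : f 0 = i + 1) {x : ℕ} (hx : i + 2 ≤ x)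
    (hxn : x < n) : i + 2 ≤ f x := by
  have hb := hf.2.1 x hxn
  have hc := hf.2.1 0 (by omega)
  by_contra! hlt
  rcases Nat.eq_zero_or_pos (f x) with h | h
  · rw [h] at hb
    omega
  · rcases Nat.lt_or_ge (f x) (i + 1) with h' | h'
    · obtain ⟨y, hy⟩ : ∃ y, f x = y + 1 := ⟨f x - 1, by omega⟩
      have := hf.lt_of_lt hi h0 (x := y) (by omega)
      rw [← hy] at this
      omega
    · have he : f x = f 0 := by omega
      rw [he, hc.2.1] at hb
      omega

/-- A non-crossing matching pairing `0` with `i + 1` splits into its parts inside and outside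
of this pair. -/
theorem card_isNoncrossingOn_and_eq (i l : ℕ) (σ : ℕ → Bool) (hσ : σ (i + 1) = !σ 0) :
    Nat.card {f : ℕ → ℕ // IsNoncrossingOn (i + l + 2) σ f ∧ f 0 = i + 1}
      = noncrossingCount i (fun x => σ (x + 1)) * noncrossingCount l fun x => σ (x + (i + 2)) := by
  rw [noncrossingCount, noncrossingCount, ← Nat.card_prod]
  refine Nat.card_congr
    { toFun := fun f =>
        (⟨fun x => if x < i then f.1 (x + 1) - 1 else x, ?_, ?_, ?_⟩,
          ⟨fun x => f.1 (x + (i + 2)) - (i + 2), ?_, ?_, ?_⟩)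
      invFun := fun gh => ⟨fun x => if x = 0 then i + 1 else if x = i + 1 then 0 else
        if x ≤ i then gh.1.1 (x - 1) + 1 else gh.2.1 (x - (i + 2)) + (i + 2), ⟨?_, ?_, ?_⟩, ?_⟩
      left_inv := ?_
      right_inv := ?_ }
  · intro x hx
    simp [Nat.not_lt.2 hx]
  · intro x hx
    obtain ⟨f, hf, h0⟩ := f
    have h1 := hf.lt_of_lt (by omega) h0 hx
    have h2 := hf.2.1 (x + 1) (by omega)
    have h3 : f (x + 1) - 1 < i := by omega
    have h4 : f (x + 1) - 1 + 1 = f (x + 1) := by omega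
    simp only [hx, if_true, h3, h4]
    refine ⟨trivial, ?_, ?_, h2.2.2.2⟩
    · rw [h2.2.1]; omega
    · omega
  · intro a b hab hb
    obtain ⟨f, hf, h0⟩ := f
    dsimp only at hb ⊢
    by_cases ha : a < i
    · have h1 := hf.lt_of_lt (by omega) h0 ha
      rw [if_pos ha] at hb ⊢
      have hbi : b < i := by omega
      have h2 := hf.2.2 (a + 1) (b + 1) (by omega) (by omega)
      rw [if_pos hbi]
      omega
    · rw [if_neg ha] at hb
      omega
  · intro x hx
    have := f.2.1.1 (x + (i + 2)) (by omega)
    dsimp only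
    omega
  · intro x hx
    obtain ⟨f, hf, h0⟩ := f
    have h1 := hf.le_of_le (by omega) h0 (x := x + (i + 2)) (by omega) (by omega)
    have h2 := hf.2.1 (x + (i + 2)) (by omega)
    have h4 : f (x + (i + 2)) - (i + 2) + (i + 2) = f (x + (i + 2)) := by omega
    simp only [h4]
    refine ⟨by omega, ?_, by omega, h2.2.2.2⟩
    rw [h2.2.1]; omega
  · intro a b hab hb
    dsimp only at hb ⊢
    have := f.2.1.2.2 (a + (i + 2)) (b + (i + 2)) (by omega) (by omega)
    omega
  · intro x hx
    have := gh.2.2.1 (x - (i + 2)) (by omega)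
    dsimp only
    rw [if_neg (by omega), if_neg (by omega), if_neg (by omega)]
    omega
  · intro x hx
    obtain ⟨⟨g, hg⟩, ⟨h, hh⟩⟩ := gh
    dsimp only
    by_cases h0 : x = 0
    · subst h0
      simp [hσ]
    by_cases h1 : x = i + 1
    · subst h1
      simp [hσ]
    by_cases h2 : x ≤ i
    · have h3 := hg.2.1 (x - 1) (by omega)
      have h4 : x - 1 + 1 = x := by omega
      dsimp only at h3
      rw [h4] at h3
      rw [if_neg h0, if_neg h1, if_pos h2, if_neg (by omega), if_neg (by omega),
        if_pos (by omega), Nat.add_sub_cancel, h3.2.1]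
      exact ⟨by omega, h4, by omega, h3.2.2.2⟩
    · have h3 := hh.2.1 (x - (i + 2)) (by omega)
      have h4 : x - (i + 2) + (i + 2) = x := by omega
      dsimp only at h3
      rw [h4] at h3
      rw [if_neg h0, if_neg h1, if_neg h2, if_neg (by omega), if_neg (by omega),
        if_neg (by omega), Nat.add_sub_cancel, h3.2.1]
      exact ⟨by omega, h4, by omega, h3.2.2.2⟩
  · intro a b hab hb
    obtain ⟨⟨g, hg⟩, ⟨h, hh⟩⟩ := gh
    dsimp only at hb ⊢
    have hgb : ∀ x, x < i → g x < i := fun x hx => (hg.2.1 x hx).1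
    by_cases h0 : a = 0
    · rw [if_pos h0] at hb ⊢
      have := hgb (b - 1)
      rw [if_neg (by omega), if_neg (by omega), if_pos (by omega)]
      omega
    by_cases h1 : a = i + 1
    · rw [if_neg h0, if_pos h1] at hb
      omega
    by_cases h2 : a ≤ i
    · rw [if_neg h0, if_neg h1, if_pos h2] at hb ⊢
      have h3 := hgb (a - 1) (by omega)
      have := hg.2.2 (a - 1) (b - 1) (by omega) (by omega)
      rw [if_neg (by omega), if_neg (by omega), if_pos (by omega)]
      omega
    · rw [if_neg h0, if_neg h1, if_neg h2] at hb ⊢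
      have := hh.2.2 (a - (i + 2)) (b - (i + 2)) (by omega) (by omega)
      rw [if_neg (by omega), if_neg (by omega), if_neg (by omega)]
      omega
  · simp
  · rintro ⟨f, hf, h0⟩
    refine Subtype.ext (funext fun x => ?_)
    dsimp only
    split_ifs with h1 h2 h3 h4
    · rw [h1, h0]
    · have := (hf.2.1 0 (by omega)).2.1
      rw [h2, ← h0, this]
    · have h5 := hf.lt_of_lt (by omega) h0 (x := x - 1) (by omega)
      have h6 : x - 1 + 1 = x := by omega
      rw [h6] at h5 ⊢
      omega
    · omega
    · have h6 : x - (i + 2) + (i + 2) = x := by omega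
      rw [h6]
      rcases Nat.lt_or_ge x (i + l + 2) with h | h
      · have h5 := hf.le_of_le (by omega) h0 (x := x) (by omega) h
        omega
      · have h5 := hf.1 x h
        omega
  · rintro ⟨⟨g, hg⟩, ⟨h, hh⟩⟩
    refine Prod.ext (Subtype.ext (funext fun x => ?_)) (Subtype.ext (funext fun x => ?_))
    · dsimp only
      by_cases hx : x < i
      · rw [if_pos hx, if_neg (by omega), if_neg (by omega), if_pos (by omega)]
        simp
      · rw [if_neg hx, hg.1 x (by omega)]
    · dsimp only
      rw [if_neg (by omega), if_neg (by omega), if_neg (by omega)]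
      simp

theorem noncrossingCount_succ (n : ℕ) (σ : ℕ → Bool) :
    noncrossingCount (n + 1) σ = ∑ i ∈ Finset.range n, if σ (i + 1) = !σ 0 then
      noncrossingCount i (fun x => σ (x + 1)) *
        noncrossingCount (n - (i + 1)) (fun x => σ (x + (i + 2))) else 0 := by
  have hfib : ∀ f : {f : ℕ → ℕ // IsNoncrossingOn (n + 1) σ f}, f.1 0 - 1 < n := by
    rintro ⟨f, hf⟩
    have := hf.2.1 0 (by omega)
    dsimp only
    omega
  rw [noncrossingCount, Nat.card_congr (Equiv.sigmaFiberEquiv fun f => (⟨_, hfib f⟩ : Fin n)).symm,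
    Nat.card_sigma, Finset.sum_range]
  refine Finset.sum_congr rfl fun i _ => ?_
  have h1 : Nat.card {f : {f : ℕ → ℕ // IsNoncrossingOn (n + 1) σ f} //
        (⟨_, hfib f⟩ : Fin n) = i}
      = Nat.card {f : ℕ → ℕ // IsNoncrossingOn (n + 1) σ f ∧ f 0 = i + 1} := by
    refine Nat.card_congr ((Equiv.subtypeEquivRight fun f => ?_).trans
      (Equiv.subtypeSubtypeEquivSubtypeInter _ fun f : ℕ → ℕ => f 0 = i + 1))
    have := f.2.2.1 0 (by omega)
    rw [Fin.ext_iff]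
    dsimp only
    omega
  rw [h1]
  split_ifs with hσ
  · rw [← card_isNoncrossingOn_and_eq i (n - (i + 1)) σ hσ]
    have h2 : (i : ℕ) + (n - (i + 1)) + 2 = n + 1 := by omega
    rw [h2]
  · have : IsEmpty {f : ℕ → ℕ // IsNoncrossingOn (n + 1) σ f ∧ f 0 = i + 1} := by
      refine ⟨fun ⟨f, hf, h0⟩ => hσ ?_⟩
      have := (hf.2.1 0 (by omega)).2.2.2
      rwa [h0] at this
    exact Nat.card_of_isEmpty

theorem sum_map_letterCuts {R : Type*} [AddCommMonoid R] (b : Bool) (w : List Bool)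
    (F : List Bool × List Bool → R) :
    ((letterCuts b w).map F).sum = ∑ i ∈ Finset.range w.length,
      if w.getD i true = b then F (w.take i, w.drop (i + 1)) else 0 := by
  induction w generalizing F with
  | nil => simp [letterCuts]
  | cons c w ih =>
    rw [letterCuts, List.length_cons, Finset.sum_range_succ', List.map_append, List.sum_append,
      List.map_map, ih, add_comm]
    refine congrArg₂ (· + ·) (by simp) ?_
    by_cases hc : c = b <;> simp [hc]

theorem matchingCount_nil : matchingCount [] = 1 := by
  rw [matchingCount_eq_noncrossingCount, noncrossingCount, Nat.card_eq_one_iff_unique]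
  refine ⟨⟨fun f g => Subtype.ext (funext fun x => ?_)⟩, ⟨id, by simp, by simp, ?_⟩⟩
  · rw [f.2.1 x (by simp), g.2.1 x (by simp)]
  · intro a b h1 h2
    exact absurd h1 h2.not_gt

theorem matchingCount_cons (b : Bool) (w : List Bool) :
    matchingCount (b :: w)
      = ((letterCuts (!b) w).map fun uv => matchingCount uv.1 * matchingCount uv.2).sum := by
  rw [sum_map_letterCuts, matchingCount_eq_noncrossingCount, List.length_cons,
    noncrossingCount_succ]
  refine Finset.sum_congr rfl fun i hi => ?_
  have hi := Finset.mem_range.1 hi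
  simp only [List.getD_cons_succ, List.getD_cons_zero, matchingCount_eq_noncrossingCount,
    List.length_take, List.length_drop, min_eq_left hi.le]
  refine if_congr Iff.rfl (congrArg₂ (· * ·) (noncrossingCount_congr fun x hx => ?_)
    (noncrossingCount_congr fun x hx => ?_)) rfl
  · simp [List.getD_eq_getElem?_getD, hx]
  · have h : x + (i + 2) = (x + (i + 1)) + 1 := by omega
    simp only [h, List.getD_cons_succ]
    simp [List.getD_eq_getElem?_getD, add_comm]

end NoncrossingRecursion

section Convergence

/-- A size of a list of words which decreases in the Schwinger–Dyson equation. -/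
def totalSize (S : List (List Bool)) : ℕ := (S.map fun s => s.length + 1).sum

theorem length_of_mem_letterCuts {b : Bool} {w : List Bool} {uv : List Bool × List Bool}
    (h : uv ∈ letterCuts b w) : uv.1.length + uv.2.length + 1 = w.length := by
  induction w generalizing uv with
  | nil => simp [letterCuts] at h
  | cons c w ih =>
    rw [letterCuts, List.mem_append, List.mem_map] at h
    rcases h with h | ⟨uv', h, rfl⟩
    · split_ifs at h
      · rw [List.mem_singleton.1 h]
        simp
      · simp at h
    · have := ih h
      simp only [List.length_cons]
      omega

theorem totalSize_of_mem_cyclicSplices {b : Bool} {w : List Bool} {S S' : List (List Bool)}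
    (h : S' ∈ cyclicSplices b w S) : totalSize S' + 1 = totalSize S + w.length := by
  induction S generalizing S' with
  | nil => simp [cyclicSplices] at h
  | cons s S ih =>
    rw [cyclicSplices, List.mem_append, List.mem_map, List.mem_map] at h
    rcases h with ⟨uv, h, rfl⟩ | ⟨S'', h, rfl⟩
    · have := length_of_mem_letterCuts h
      simp only [totalSize, List.map_cons, List.sum_cons, List.length_append]
      omega
    · have := ih h
      simp only [totalSize, List.map_cons, List.sum_cons] at this ⊢
      omega

theorem tendsto_sum_map {α : Type*} (l : List α) (f : ℕ → α → ℂ) (g : α → ℂ)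
    (h : ∀ a ∈ l, Filter.Tendsto (fun n => f n a) Filter.atTop (nhds (g a))) :
    Filter.Tendsto (fun n => (l.map (f n)).sum) Filter.atTop (nhds (l.map g).sum) := by
  induction l with
  | nil => simp
  | cons a l ih =>
    simp only [List.map_cons, List.sum_cons]
    exact (h a (by simp)).add (ih fun b hb => h b (by simp [hb]))

/-- Expected products of normalized traces of Ginibre words factorize in the limit. -/
theorem tendsto_gaussianExpect_wordTraceProd (S : List (List Bool)) :
    Filter.Tendsto (fun n => gaussianExpect (EntryIndex n) (wordTraceProd n S)) Filter.atTop
      (nhds (S.map fun s => (matchingCount s : ℂ)).prod) := by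
  induction hN : totalSize S using Nat.strong_induction_on generalizing S with
  | h N ih =>
  subst hN
  rcases S with _ | ⟨_ | ⟨b, w⟩, S⟩
  · simp [wordTraceProd, gaussianExpect_one]
  · have h := ih (totalSize S) (by simp [totalSize]) S rfl
    simp only [List.map_cons, List.prod_cons, matchingCount_nil, Nat.cast_one, one_mul]
    refine h.congr' ?_
    filter_upwards [Filter.eventually_ne_atTop 0] with n hn
    have h1 : wordTrace n [] = 1 := by
      have hn : (n : ℂ) ≠ 0 := Nat.cast_ne_zero.2 hn
      rw [wordTrace, wordMatrix_nil, Matrix.trace_one, Fintype.card_fin, ← map_natCast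
        MvPolynomial.C, ← map_mul, inv_mul_cancel₀ hn, map_one]
    rw [wordTraceProd_cons, h1, one_mul]
  · have h1 := tendsto_sum_map (letterCuts (!b) w) _ _ fun uv huv =>
      ih (totalSize (uv.1 :: uv.2 :: S)) (by
        have := length_of_mem_letterCuts huv
        simp only [totalSize, List.map_cons, List.sum_cons, List.length_cons]
        omega) (uv.1 :: uv.2 :: S) rfl
    have h2 := tendsto_sum_map (cyclicSplices b w S) _ _ fun S' hS' =>
      ih (totalSize S') (by
        have := totalSize_of_mem_cyclicSplices hS'
        simp only [totalSize, List.map_cons, List.sum_cons, List.length_cons] at this ⊢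
        omega) S' rfl
    have h0 : Filter.Tendsto (fun n : ℕ => (n : ℂ)⁻¹) Filter.atTop (nhds 0) :=
      tendsto_inv_atTop_nhds_zero_nat (𝕜 := ℂ)
    have h3 := h1.add (h0.mul (h0.mul h2))
    simp only [zero_mul, add_zero, List.map_cons, List.prod_cons, ← mul_assoc] at h3
    rw [List.sum_map_mul_right] at h3
    rw [List.map_cons, List.prod_cons, matchingCount_cons]
    push_cast [List.map_map, Function.comp_def]
    refine h3.congr' ?_
    filter_upwards [Filter.eventually_ne_atTop 0] with n hn
    rw [gaussianExpect_wordTraceProd_cons (Nat.cast_ne_zero.2 hn), mul_assoc]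

theorem pairEval_letterMatrix (n : ℕ) (ω : (EntryIndex n → ℝ) × (EntryIndex n → ℝ)) (b : Bool) :
    (letterMatrix n b).map (pairEval ω)
      = if b then ginibreMatrix n ω else (ginibreMatrix n ω)ᴴ := by
  ext j k
  cases b
  · simp [letterMatrix, pairEval, spinIndex, spinUnit, ginibreMatrix, ginibreScale,
      Matrix.conjTranspose_apply, div_eq_inv_mul]
    ring
  · simp [letterMatrix, pairEval, spinIndex, spinUnit, ginibreMatrix, ginibreScale,
      div_eq_inv_mul]
    ring

theorem ginibreMixedMoment_eq_gaussianExpect (n k : ℕ) (p q : Fin k → ℕ) :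
    ginibreMixedMoment n k p q
      = gaussianExpect (EntryIndex n) (wordTraceProd n [spinList k p q]) := by
  change _ = ∫ ω, pairEval ω _ ∂(gaussianPair _)
  rw [ginibreMixedMoment]
  refine integral_congr_ae (Filter.Eventually.of_forall fun ω => ?_)
  have h : (pairEval ω).mapMatrix (wordMatrix n (spinList k p q))
      = (List.ofFn fun i : Fin k =>
        (ginibreMatrix n ω) ^ (p i) * ((ginibreMatrix n ω)ᴴ) ^ (q i)).prod := by
    rw [wordMatrix, map_list_prod, List.map_map, spinList, List.map_flatten, List.prod_flatten,
      List.map_map, List.map_ofFn]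
    simp [Function.comp_def, pairEval_letterMatrix]
  dsimp only
  rw [← h, wordTraceProd, List.map_singleton, List.prod_singleton, wordTrace, map_mul,
    AlgHom.mapMatrix_apply, ← AddMonoidHom.map_trace (pairEval ω)]
  simp [pairEval]

end Convergence

/-- Convergence of the mixed matrix moments of the complex Ginibre ensemble:
`m_n(p,q) → m(p,q)`, the number of non-crossing perfect matchings of the spin
sequence of `(p,q)` in which every matched pair has one `+1` and one `-1` spin. -/
theorem ginibre_mixedMoment_tendsto_matchingCount (k : ℕ) (hk : 1 ≤ k)
    (p q : Fin k → ℕ) :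
    Filter.Tendsto (fun n : ℕ => ginibreMixedMoment n k p q) Filter.atTop
      (nhds ((matchingCount (spinList k p q) : ℕ) : ℂ)) := by
  simp only [ginibreMixedMoment_eq_gaussianExpect]
  simpa using tendsto_gaussianExpect_wordTraceProd [spinList k p q]
end

section
/- Let f : ℝ^n → ℝ be differentiable with ‖∇f‖_∞² := sup_{x ∈ ℝ^n} Σ_{k=1}^n (∂f/∂x_k (x))² < ∞. If U = (U_1,…,U_n) and V = (V_1,…,V_n) are independent random vectors whose 2n coordinates are i.i.d. standard real Gaussians, then E[(f(U) − f(V))²] ≤ 2 ‖∇f‖_∞². -/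
open MeasureTheory ProbabilityTheory

/-- The variance of `f` under the translate of `ρ` by `x`. -/
noncomputable def translateVariance {E : Type*} [NormedAddCommGroup E] [MeasurableSpace E]
    (ρ : Measure E) (f : E → ℝ) (x : E) : ℝ :=
  ∫ z, f (x + z) ^ 2 ∂ρ - (∫ z, f (x + z) ∂ρ) ^ 2

lemma translateVariance_le_integral_sq_sub {E : Type*} [NormedAddCommGroup E]
    [MeasurableSpace E] {f : E → ℝ} {ρ : Measure E} [IsProbabilityMeasure ρ]
    {x : E} (hf : MemLp (fun z ↦ f (x + z)) 2 ρ) (c : ℝ) :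
    translateVariance ρ f x ≤ ∫ z, (f (x + z) - c) ^ 2 ∂ρ := by
  have h1 : Integrable (fun z ↦ f (x + z)) ρ := hf.integrable (by norm_num)
  have h2 : Integrable (fun z ↦ f (x + z) ^ 2) ρ := hf.integrable_sq
  have : ∫ z, (f (x + z) - c) ^ 2 ∂ρ
      = ∫ z, f (x + z) ^ 2 ∂ρ - 2 * c * ∫ z, f (x + z) ∂ρ + c ^ 2 := by
    have h3 : Integrable (fun z ↦ f (x + z) ^ 2 - 2 * c * f (x + z)) ρ := h2.sub (h1.const_mul _)
    calc ∫ z, (f (x + z) - c) ^ 2 ∂ρ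
        = ∫ z, (f (x + z) ^ 2 - 2 * c * f (x + z) + c ^ 2) ∂ρ := by
          congr with z
          ring
      _ = _ := by
          rw [integral_add h3 (integrable_const _), integral_sub h2 (h1.const_mul _),
            integral_const_mul]
          simp
  rw [this, translateVariance]
  nlinarith [sq_nonneg (∫ z, f (x + z) ∂ρ - c)]

section Averaging

variable {E : Type*} [NormedAddCommGroup E] [NormedSpace ℝ E]

lemma norm_sub_le_of_norm_fderiv_le {f : E → ℝ} {L : ℝ} (hf : Differentiable ℝ f)
    (hL : ∀ x, ‖fderiv ℝ f x‖ ≤ L) (x y : E) : ‖f y - f x‖ ≤ L * ‖y - x‖ :=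
  convex_univ.norm_image_sub_le_of_norm_fderiv_le (fun z _ ↦ hf z) (fun z _ ↦ hL z)
    (Set.mem_univ x) (Set.mem_univ y)

lemma abs_sub_fderiv_le_of_lipschitz_fderiv {f : E → ℝ} {M : ℝ} (hf : Differentiable ℝ f)
    (hM : ∀ x y, ‖fderiv ℝ f x - fderiv ℝ f y‖ ≤ M * ‖x - y‖) (x h : E) :
    |f (x + h) - f x - fderiv ℝ f x h| ≤ M * ‖h‖ * ‖h‖ := by
  have hM0 : 0 ≤ M * ‖h‖ := by
    have := (norm_nonneg _).trans (hM (x + h) x)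
    simpa using this
  have key := (convex_segment x (x + h)).norm_image_sub_le_of_norm_hasFDerivWithin_le'
    (f := f) (f' := fderiv ℝ f) (φ := fderiv ℝ f x) (C := M * ‖h‖)
    (fun z _ ↦ (hf z).hasFDerivAt.hasFDerivWithinAt) ?_
    (left_mem_segment ℝ x (x + h)) (right_mem_segment ℝ x (x + h))
  · simpa using key
  · rintro z hz
    rw [segment_eq_image'] at hz
    obtain ⟨θ, hθ, rfl⟩ := hz
    refine (hM _ _).trans ?_
    simp only [add_sub_cancel_left, norm_smul, Real.norm_eq_abs, abs_of_nonneg hθ.1]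
    nlinarith [hθ.2]

variable [FiniteDimensional ℝ E] [MeasurableSpace E] [BorelSpace E]

lemma memLp_comp_add_of_norm_fderiv_le {f : E → ℝ} {L : ℝ} (hf : Differentiable ℝ f)
    (hL : ∀ x, ‖fderiv ℝ f x‖ ≤ L) {ρ : Measure E} [IsProbabilityMeasure ρ] {p : ENNReal}
    (hρ : MemLp id p ρ) (x : E) : MemLp (fun z ↦ f (x + z)) p ρ := by
  have hn : MemLp (fun z : E ↦ ‖z‖) p ρ := hρ.norm
  have hg : MemLp (fun z ↦ |f x| + L * ‖z‖) p ρ :=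
    MemLp.add (f := fun _ ↦ |f x|) (g := fun z ↦ L * ‖z‖) (memLp_const _) (hn.const_mul L)
  refine hg.mono (by have := hf.continuous; fun_prop) (.of_forall fun z ↦ ?_)
  have h1 := norm_sub_le_of_norm_fderiv_le hf hL x (x + z)
  rw [add_sub_cancel_left] at h1
  rw [Real.norm_eq_abs] at *
  rw [Real.norm_eq_abs]
  refine le_trans ?_ (le_abs_self _)
  have := abs_add_le (f x) (f (x + z) - f x)
  rw [add_sub_cancel] at this
  linarith

lemma integrable_fderiv_comp_add {f : E → ℝ} {L : ℝ} (hL : ∀ x, ‖fderiv ℝ f x‖ ≤ L)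
    {ρ : Measure E} [IsProbabilityMeasure ρ] (x : E) :
    Integrable (fun z ↦ fderiv ℝ f (x + z)) ρ :=
  Integrable.of_bound
    ((measurable_fderiv ℝ f).comp (measurable_const_add x)).aestronglyMeasurable L
    (.of_forall fun _ ↦ hL _)

lemma hasFDerivAt_integral_comp_add {f : E → ℝ} {L : ℝ} (hf : Differentiable ℝ f)
    (hL : ∀ x, ‖fderiv ℝ f x‖ ≤ L) {ρ : Measure E} [IsProbabilityMeasure ρ]
    (hρ : MemLp id 1 ρ) (x : E) :
    HasFDerivAt (fun x ↦ ∫ z, f (x + z) ∂ρ) (∫ z, fderiv ℝ f (x + z) ∂ρ) x := by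
  refine hasFDerivAt_integral_of_dominated_of_fderiv_le
    (F' := fun x z ↦ fderiv ℝ f (x + z)) (bound := fun _ ↦ L) Filter.univ_mem
    (.of_forall fun y ↦ ?_) ?_ ?_ (.of_forall fun z y _ ↦ hL _) (integrable_const L)
    (.of_forall fun z y _ ↦ ?_)
  · exact (memLp_comp_add_of_norm_fderiv_le hf hL hρ y).1
  · exact memLp_one_iff_integrable.1 (memLp_comp_add_of_norm_fderiv_le hf hL hρ x)
  · exact (integrable_fderiv_comp_add hL x).1
  · exact (hasFDerivAt_comp_add_right z).2 (hf (y + z)).hasFDerivAt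

lemma norm_fderiv_integral_comp_add_le {f : E → ℝ} {L : ℝ} (hf : Differentiable ℝ f)
    (hL : ∀ x, ‖fderiv ℝ f x‖ ≤ L) {ρ : Measure E} [IsProbabilityMeasure ρ]
    (hρ : MemLp id 1 ρ) (x : E) : ‖fderiv ℝ (fun x ↦ ∫ z, f (x + z) ∂ρ) x‖ ≤ L := by
  rw [(hasFDerivAt_integral_comp_add hf hL hρ x).fderiv]
  simpa using norm_integral_le_of_norm_le_const (μ := ρ) (.of_forall fun z ↦ hL (x + z))

lemma norm_fderiv_integral_comp_add_sub_le {f : E → ℝ} {L M : ℝ} (hf : Differentiable ℝ f)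
    (hL : ∀ x, ‖fderiv ℝ f x‖ ≤ L) (hM : ∀ x y, ‖fderiv ℝ f x - fderiv ℝ f y‖ ≤ M * ‖x - y‖)
    {ρ : Measure E} [IsProbabilityMeasure ρ] (hρ : MemLp id 1 ρ) (x y : E) :
    ‖fderiv ℝ (fun x ↦ ∫ z, f (x + z) ∂ρ) x - fderiv ℝ (fun x ↦ ∫ z, f (x + z) ∂ρ) y‖
      ≤ M * ‖x - y‖ := by
  rw [(hasFDerivAt_integral_comp_add hf hL hρ x).fderiv,
    (hasFDerivAt_integral_comp_add hf hL hρ y).fderiv,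
    ← integral_sub (integrable_fderiv_comp_add hL x) (integrable_fderiv_comp_add hL y)]
  refine (norm_integral_le_of_norm_le_const (C := M * ‖x - y‖) (.of_forall fun z ↦ ?_)).trans ?_
  · simpa using hM (x + z) (y + z)
  · simp

lemma translateVariance_conv_le {f : E → ℝ} {L B : ℝ} (hf : Differentiable ℝ f)
    (hL : ∀ x, ‖fderiv ℝ f x‖ ≤ L) {μ ν : Measure E} [IsProbabilityMeasure μ]
    [IsProbabilityMeasure ν] (hμ : MemLp id 2 μ) (hν : MemLp id 2 ν)
    (hμν : MemLp id 2 (μ ∗ ν)) (hB : ∀ x, translateVariance ν f x ≤ B) (x : E) :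
    translateVariance (μ ∗ ν) f x
      ≤ translateVariance μ (fun x ↦ ∫ z, f (x + z) ∂ν) x + B := by
  have hm := memLp_comp_add_of_norm_fderiv_le hf hL hμν x
  have hν1 : MemLp id 1 ν := hν.mono_exponent (by norm_num)
  have hsq := hm.integrable_sq
  have hP := (memLp_comp_add_of_norm_fderiv_le (f := fun x ↦ ∫ z, f (x + z) ∂ν)
    (fun x ↦ (hasFDerivAt_integral_comp_add hf hL hν1 x).differentiableAt)
    (norm_fderiv_integral_comp_add_le hf hL hν1) hμ x).integrable_sq
  have hsq' : Integrable (fun y ↦ ∫ z, f (x + (y + z)) ^ 2 ∂ν) μ := by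
    have h : Integrable (fun p : E × E ↦ f (x + (p.1 + p.2)) ^ 2) (μ.prod ν) :=
      (integrable_map_measure hsq.1 (by fun_prop)).1 hsq
    exact h.integral_prod_left
  have key : ∫ y, translateVariance ν f (x + y) ∂μ ≤ B := by
    have := integral_mono (μ := μ) (f := fun y ↦ translateVariance ν f (x + y))
      (g := fun _ ↦ B) ?_ (integrable_const B) (fun y ↦ hB _)
    · simpa using this
    · simp only [translateVariance, add_assoc] at *
      exact hsq'.sub hP
  simp only [translateVariance, add_assoc] at *
  rw [integral_sub hsq' hP] at key
  rw [integral_conv hsq, integral_conv (hm.integrable (by norm_num))]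
  linarith

lemma exists_lipschitz_fderiv_approx {f : E → ℝ} {L : ℝ} (hf : Differentiable ℝ f)
    (hL : ∀ x, ‖fderiv ℝ f x‖ ≤ L) {ε : ℝ} (hε : 0 < ε) :
    ∃ (g : E → ℝ) (M : ℝ), Differentiable ℝ g ∧ (∀ x, ‖fderiv ℝ g x‖ ≤ L) ∧
      (∀ x y, ‖fderiv ℝ g x - fderiv ℝ g y‖ ≤ M * ‖x - y‖) ∧ ∀ x, |g x - f x| ≤ L * ε := by
  have hL0 : 0 ≤ L := (norm_nonneg _).trans (hL 0)
  let b : ContDiffBump (0 : E) := ⟨ε / 2, ε, by positivity, by linarith⟩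
  let m : Measure E := Measure.addHaar
  let φ : E → ℝ := b.normed m
  have hφ0 (z : E) : 0 ≤ φ z := b.nonneg_normed z
  have hφc : Continuous φ := b.continuous_normed
  have hφi : Integrable φ m := b.integrable_normed
  have hφz {z : E} (hz : z ∉ Metric.ball 0 ε) : φ z = 0 := by
    have := b.support_normed_eq (μ := m)
    rw [← Function.notMem_support]
    change z ∉ Function.support (b.normed m)
    rwa [this]
  obtain ⟨K, hK⟩ := ContDiff.lipschitzWith_of_hasCompactSupport (𝕂 := ℝ) (n := 1)
    (b.hasCompactSupport_normed (μ := m)) (b.contDiff_normed (n := 1)) one_ne_zero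
  let ρ : Measure E := m.withDensity fun z ↦ ENNReal.ofReal (φ z)
  have hρ : IsProbabilityMeasure ρ := by
    refine ⟨?_⟩
    rw [withDensity_apply _ .univ, Measure.restrict_univ,
      ← ofReal_integral_eq_lintegral_ofReal hφi (.of_forall hφ0), b.integral_normed,
      ENNReal.ofReal_one]
  have hbd : ∀ᵐ z ∂ρ, ‖z‖ ≤ ε := by
    rw [ae_withDensity_iff (by fun_prop)]
    refine .of_forall fun z hz ↦ ?_
    by_contra h
    refine hz ?_
    rw [hφz (by simpa using (not_le.1 h).le), ENNReal.ofReal_zero]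
  have hρ1 : MemLp id 1 ρ := MemLp.of_bound (by fun_prop) ε hbd
  have hD (x : E) : ∫ z, fderiv ℝ f (x + z) ∂ρ = ∫ w, φ (w - x) • fderiv ℝ f w ∂m := by
    rw [integral_withDensity_eq_integral_toReal_smul (by fun_prop) (.of_forall fun _ ↦ by simp),
      ← integral_add_left_eq_self (fun w ↦ φ (w - x) • fderiv ℝ f w) x]
    simp only [ENNReal.toReal_ofReal (hφ0 _), add_sub_cancel_left]
  have hDi (x : E) : Integrable (fun w ↦ φ (w - x) • fderiv ℝ f w) m := by
    refine ((hφi.comp_sub_right x).mul_const L).mono' ?_ (.of_forall fun w ↦ ?_)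
    · exact (hφi.comp_sub_right x).1.smul (measurable_fderiv ℝ f).aestronglyMeasurable
    · rw [norm_smul, Real.norm_of_nonneg (hφ0 _)]
      exact mul_le_mul_of_nonneg_left (hL w) (hφ0 _)
  refine ⟨fun x ↦ ∫ z, f (x + z) ∂ρ, K * L * (2 * m.real (Metric.closedBall 0 ε)),
    fun x ↦ (hasFDerivAt_integral_comp_add hf hL hρ1 x).differentiableAt,
    norm_fderiv_integral_comp_add_le hf hL hρ1, fun x y ↦ ?_, fun x ↦ ?_⟩
  · rw [(hasFDerivAt_integral_comp_add hf hL hρ1 x).fderiv,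
      (hasFDerivAt_integral_comp_add hf hL hρ1 y).fderiv, hD, hD, ← integral_sub (hDi x) (hDi y),
      ← setIntegral_eq_integral_of_forall_compl_eq_zero
        (s := Metric.closedBall x ε ∪ Metric.closedBall y ε)]
    · refine (norm_setIntegral_le_of_norm_le_const (C := K * ‖x - y‖ * L) ?_ fun w _ ↦ ?_).trans ?_
      · exact (measure_union_le _ _).trans_lt
          (ENNReal.add_lt_top.2 ⟨measure_closedBall_lt_top, measure_closedBall_lt_top⟩)
      · rw [← sub_smul, norm_smul]
        refine mul_le_mul ?_ (hL w) (norm_nonneg _) (by positivity)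
        have := hK.norm_sub_le (w - x) (w - y)
        rwa [sub_sub_sub_cancel_left, norm_sub_rev y x] at this
      · have h1 (x : E) : m.real (Metric.closedBall x ε) = m.real (Metric.closedBall 0 ε) := by
          simp only [Measure.real, m, Measure.addHaar_closedBall_center]
        have h2 := measureReal_union_le (μ := m) (Metric.closedBall x ε) (Metric.closedBall y ε)
        rw [h1 x, h1 y, ← two_mul] at h2
        refine (mul_le_mul_of_nonneg_left h2 (by positivity)).trans (le_of_eq ?_)
        ring
    · intro w hw
      simp only [Set.mem_union, not_or, Metric.mem_closedBall, dist_eq_norm, not_le] at hw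
      rw [hφz (by simpa using hw.1.le), hφz (by simpa using hw.2.le)]
      simp
  · have hfi : Integrable (fun z ↦ f (x + z)) ρ :=
      memLp_one_iff_integrable.1 (memLp_comp_add_of_norm_fderiv_le hf hL hρ1 x)
    have h := norm_integral_le_of_norm_le_const (μ := ρ) (f := fun z ↦ f (x + z) - f x)
      (C := L * ε) ?_
    · rw [integral_sub hfi (integrable_const _)] at h
      simpa using h
    · filter_upwards [hbd] with z hz
      have := norm_sub_le_of_norm_fderiv_le hf hL x (x + z)
      rw [add_sub_cancel_left] at this
      exact this.trans (mul_le_mul_of_nonneg_left hz hL0)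

end Averaging

section Gaussian

variable {E : Type*} [NormedAddCommGroup E] [InnerProductSpace ℝ E] [FiniteDimensional ℝ E]
  [MeasurableSpace E]

variable (E) in
/-- The law of `r • Z` for a standard Gaussian vector `Z`. -/
noncomputable def scaledGaussian (r : ℝ) : Measure E := (stdGaussian E).map (r • ·)

lemma scaledGaussian_one : scaledGaussian E 1 = stdGaussian E := by
  simp [scaledGaussian]

variable [BorelSpace E]

instance isProbabilityMeasure_scaledGaussian (r : ℝ) :
    IsProbabilityMeasure (scaledGaussian E r) :=
  Measure.isProbabilityMeasure_map (by fun_prop)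

lemma memLp_id_scaledGaussian (r : ℝ) {p : ENNReal} (hp : p ≠ ⊤) :
    MemLp id p (scaledGaussian E r) := by
  rw [scaledGaussian, memLp_map_measure_iff (by fun_prop) (by fun_prop)]
  exact (IsGaussian.memLp_id (stdGaussian E) p hp).const_smul r

lemma scaledGaussian_conv {r s q : ℝ} (h : q ^ 2 = r ^ 2 + s ^ 2) :
    scaledGaussian E r ∗ scaledGaussian E s = scaledGaussian E q := by
  refine Measure.ext_of_charFun (funext fun t ↦ ?_)
  simp only [charFun_conv, scaledGaussian, charFun_map_smul, charFun_stdGaussian, norm_smul,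
    ← Complex.exp_add, mul_pow, Real.norm_eq_abs, Complex.ofReal_mul]
  norm_cast
  simp only [sq_abs, h]
  ring_nf

lemma integral_sq_strongDual_stdGaussian (a : StrongDual ℝ E) :
    ∫ z, a z ^ 2 ∂(stdGaussian E) = ‖a‖ ^ 2 := by
  rw [← variance_dual_stdGaussian, variance_of_integral_eq_zero (by fun_prop) (by simp)]

lemma translateVariance_scaledGaussian_le {f : E → ℝ} {L M : ℝ} (hf : Differentiable ℝ f)
    (hL : ∀ x, ‖fderiv ℝ f x‖ ≤ L) (hM : ∀ x y, ‖fderiv ℝ f x - fderiv ℝ f y‖ ≤ M * ‖x - y‖)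
    {r : ℝ} (hr : 0 ≤ r) (x : E) :
    translateVariance (scaledGaussian E r) f x
      ≤ r ^ 2 * L ^ 2 + r ^ 3 * (2 * L * M * ∫ z, ‖z‖ ^ 3 ∂(stdGaussian E)) := by
  have hmem := memLp_comp_add_of_norm_fderiv_le hf hL
    (memLp_id_scaledGaussian (E := E) r (p := 2) (by norm_num)) x
  have h3 : Integrable (fun z : E ↦ ‖z‖ ^ 3) (stdGaussian E) :=
    (IsGaussian.memLp_id (stdGaussian E) 3 (by norm_num)).integrable_norm_pow (by norm_num)
  have h2 : Integrable (fun z : E ↦ fderiv ℝ f x z ^ 2) (stdGaussian E) :=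
    (IsGaussian.memLp_dual (stdGaussian E) (fderiv ℝ f x) 2 (by norm_num)).integrable_sq
  have hcont := hf.continuous
  refine (translateVariance_le_integral_sq_sub hmem (f x)).trans ?_
  have hint : Integrable (fun z ↦ (f (x + r • z) - f x) ^ 2) (stdGaussian E) :=
    (integrable_map_measure (by fun_prop) (by fun_prop)).1
      (hmem.sub (memLp_const (f x))).integrable_sq
  rw [scaledGaussian, integral_map (by fun_prop) (by fun_prop)]
  have hle := integral_mono hint ((h2.const_mul (r ^ 2)).add (h3.const_mul (r ^ 3 * (2 * L * M))))
    (fun z ↦ ?_)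
  · simp only [Pi.add_apply] at hle
    rw [integral_add (h2.const_mul _) (h3.const_mul _), integral_const_mul, integral_const_mul,
      integral_sq_strongDual_stdGaussian] at hle
    have := pow_le_pow_left₀ (norm_nonneg _) (hL x) 2
    nlinarith [sq_nonneg r]
  · simp only [Pi.add_apply]
    have e1 := abs_sub_fderiv_le_of_lipschitz_fderiv hf hM x (r • z)
    have e2 := norm_sub_le_of_norm_fderiv_le hf hL x (x + r • z)
    have e3 := (fderiv ℝ f x).le_of_opNorm_le (hL x) (r • z)
    rw [add_sub_cancel_left] at e2
    simp only [norm_smul, Real.norm_eq_abs, abs_of_nonneg hr, map_smul, smul_eq_mul] at e1 e2 e3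
    set d := f (x + r • z) - f x
    set w := r * fderiv ℝ f x z
    have e4 : |d + w| ≤ 2 * L * (r * ‖z‖) := by
      refine (abs_add_le _ _).trans ?_
      linarith
    have e5 : (d - w) * (d + w) ≤ M * (r * ‖z‖) * (r * ‖z‖) * (2 * L * (r * ‖z‖)) := by
      refine (le_abs_self _).trans ?_
      rw [abs_mul]
      exact mul_le_mul e1 e4 (abs_nonneg _) ((abs_nonneg _).trans e1)
    have e6 : r ^ 2 * fderiv ℝ f x z ^ 2 = w ^ 2 := by simp only [w]; ring
    rw [e6]
    linarith

lemma translateVariance_scaledGaussian_sqrt_le {f : E → ℝ} {L M : ℝ} (hf : Differentiable ℝ f)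
    (hL : ∀ x, ‖fderiv ℝ f x‖ ≤ L) (hM : ∀ x y, ‖fderiv ℝ f x - fderiv ℝ f y‖ ≤ M * ‖x - y‖)
    {r : ℝ} (hr : 0 ≤ r) (k : ℕ) (x : E) :
    translateVariance (scaledGaussian E (√k * r)) f x
      ≤ k * (r ^ 2 * L ^ 2 + r ^ 3 * (2 * L * M * ∫ z, ‖z‖ ^ 3 ∂(stdGaussian E))) := by
  induction k generalizing f x with
  | zero =>
    simp only [Nat.cast_zero, Real.sqrt_zero, zero_mul, translateVariance, scaledGaussian,
      zero_smul, Measure.map_const, measure_univ, one_smul, integral_dirac, sub_self, le_refl]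
  | succ k ih =>
    have hq : (√((k + 1 : ℕ) : ℝ) * r) ^ 2 = (√(k : ℝ) * r) ^ 2 + r ^ 2 := by
      rw [mul_pow, mul_pow, Real.sq_sqrt (by positivity), Real.sq_sqrt (by positivity)]
      push_cast
      ring
    have h2 (s : ℝ) : MemLp id 2 (scaledGaussian E s) := memLp_id_scaledGaussian s (by norm_num)
    have h1 : MemLp id 1 (scaledGaussian E r) := memLp_id_scaledGaussian r (by norm_num)
    rw [← scaledGaussian_conv hq]
    refine (translateVariance_conv_le hf hL (h2 _) (h2 _) ?_
      (translateVariance_scaledGaussian_le hf hL hM hr) x).trans ?_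
    · rw [scaledGaussian_conv hq]
      exact h2 _
    · have := ih (fun x ↦ (hasFDerivAt_integral_comp_add hf hL h1 x).differentiableAt)
        (norm_fderiv_integral_comp_add_le hf hL h1)
        (norm_fderiv_integral_comp_add_sub_le hf hL hM h1) x
      push_cast
      linarith

lemma translateVariance_stdGaussian_le_of_lipschitz_fderiv {f : E → ℝ} {L M : ℝ}
    (hf : Differentiable ℝ f) (hL : ∀ x, ‖fderiv ℝ f x‖ ≤ L)
    (hM : ∀ x y, ‖fderiv ℝ f x - fderiv ℝ f y‖ ≤ M * ‖x - y‖) (x : E) :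
    translateVariance (stdGaussian E) f x ≤ L ^ 2 := by
  set K := 2 * L * M * ∫ z, ‖z‖ ^ 3 ∂(stdGaussian E) with hK
  have hlim : Filter.Tendsto (fun k : ℕ ↦ L ^ 2 + (√((k : ℝ) + 1))⁻¹ * K) Filter.atTop
      (nhds (L ^ 2 + 0 * K)) := by
    refine ((Filter.Tendsto.inv_tendsto_atTop ?_).mul_const K).const_add (L ^ 2)
    exact Real.tendsto_sqrt_atTop.comp
      (Filter.tendsto_atTop_add_const_right _ _ tendsto_natCast_atTop_atTop)
  rw [zero_mul, add_zero] at hlim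
  refine ge_of_tendsto' hlim fun k ↦ ?_
  have hs : (0 : ℝ) < √((k : ℝ) + 1) := by positivity
  have hss : √((k : ℝ) + 1) ^ 2 = (k : ℝ) + 1 := Real.sq_sqrt (by positivity)
  have key := translateVariance_scaledGaussian_sqrt_le hf hL hM (inv_nonneg.2 hs.le) (k + 1) x
  push_cast at key
  rw [mul_inv_cancel₀ hs.ne', scaledGaussian_one, ← hK] at key
  refine key.trans (le_of_eq ?_)
  nth_rewrite 1 [← hss]
  field_simp

/-- **Gaussian Poincaré inequality** for functions with bounded derivative. -/
lemma translateVariance_stdGaussian_le {f : E → ℝ} {L : ℝ} (hf : Differentiable ℝ f)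
    (hL : ∀ x, ‖fderiv ℝ f x‖ ≤ L) (x : E) :
    translateVariance (stdGaussian E) f x ≤ L ^ 2 := by
  have hL0 : 0 ≤ L := (norm_nonneg _).trans (hL 0)
  have hε (k : ℕ) : (0 : ℝ) < 1 / ((k : ℝ) + 1) := by positivity
  choose g M hg hgL hgM hgf using fun k : ℕ ↦ exists_lipschitz_fderiv_approx hf hL (hε k)
  have hlim (z : E) : Filter.Tendsto (fun k ↦ g k (x + z)) Filter.atTop (nhds (f (x + z))) := by
    rw [tendsto_iff_norm_sub_tendsto_zero]
    refine squeeze_zero (fun _ ↦ norm_nonneg _) (fun k ↦ hgf k _) ?_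
    simpa using tendsto_one_div_add_atTop_nhds_zero_nat.const_mul L
  have hmem : MemLp (fun z ↦ |f (x + z)| + L) 2 (stdGaussian E) :=
    MemLp.add (f := fun z ↦ |f (x + z)|) (g := fun _ ↦ L) (memLp_comp_add_of_norm_fderiv_le hf hL
      (IsGaussian.memLp_id (stdGaussian E) 2 (by norm_num)) x).norm (memLp_const L)
  have hbound (k : ℕ) (z : E) : |g k (x + z)| ≤ |f (x + z)| + L := by
    have h1 := abs_add_le (f (x + z)) (g k (x + z) - f (x + z))
    rw [add_sub_cancel] at h1
    have h2 : L * (1 / ((k : ℝ) + 1)) ≤ L * 1 := by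
      refine mul_le_mul_of_nonneg_left ?_ hL0
      rw [div_le_one (by positivity)]
      linarith [k.cast_nonneg (α := ℝ)]
    linarith [hgf k (x + z)]
  have hcont (k : ℕ) : Continuous (g k) := (hg k).continuous
  have h1 := tendsto_integral_of_dominated_convergence (μ := stdGaussian E)
    (F := fun k z ↦ g k (x + z)) _ (fun k ↦ by have := hcont k; fun_prop)
    (hmem.integrable (by norm_num)) (fun k ↦ .of_forall (hbound k)) (.of_forall hlim)
  have h2 := tendsto_integral_of_dominated_convergence (μ := stdGaussian E)
    (F := fun k z ↦ g k (x + z) ^ 2) _ (fun k ↦ by have := hcont k; fun_prop)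
    hmem.integrable_sq (fun k ↦ .of_forall fun z ↦ by
      rw [norm_pow]
      exact pow_le_pow_left₀ (norm_nonneg _) (hbound k z) 2)
    (.of_forall fun z ↦ (hlim z).pow 2)
  exact le_of_tendsto' (h2.sub (h1.pow 2)) fun k ↦
    translateVariance_stdGaussian_le_of_lipschitz_fderiv (hg k) (hgL k) (hgM k) x

end Gaussian

lemma integral_sub_sq_prod_self {Ω : Type*} [MeasurableSpace Ω] {μ : Measure Ω}
    [IsProbabilityMeasure μ] {f : Ω → ℝ} (hf : MemLp f 2 μ) :
    ∫ p : Ω × Ω, (f p.1 - f p.2) ^ 2 ∂(μ.prod μ)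
      = 2 * (∫ x, f x ^ 2 ∂μ - (∫ x, f x ∂μ) ^ 2) := by
  have h1 : Integrable f μ := hf.integrable (by norm_num)
  have hfst : Integrable (fun p : Ω × Ω ↦ f p.1 ^ 2) (μ.prod μ) := hf.integrable_sq.comp_fst μ
  have hsnd : Integrable (fun p : Ω × Ω ↦ f p.2 ^ 2) (μ.prod μ) := hf.integrable_sq.comp_snd μ
  have hmul : Integrable (fun p : Ω × Ω ↦ 2 * (f p.1 * f p.2)) (μ.prod μ) :=
    (h1.mul_prod h1).const_mul 2
  have hadd : Integrable (fun p : Ω × Ω ↦ f p.1 ^ 2 + f p.2 ^ 2) (μ.prod μ) := hfst.add hsnd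
  calc ∫ p : Ω × Ω, (f p.1 - f p.2) ^ 2 ∂(μ.prod μ)
      = ∫ p : Ω × Ω, (f p.1 ^ 2 + f p.2 ^ 2 - 2 * (f p.1 * f p.2)) ∂(μ.prod μ) := by
        congr with p
        ring
    _ = _ := by
        rw [integral_sub hadd hmul, integral_add hfst hsnd, integral_const_mul,
          integral_prod_mul, integral_fun_fst (fun x ↦ f x ^ 2),
          integral_fun_snd (fun x ↦ f x ^ 2)]
        simp
        ring

lemma norm_fderiv_comp_ofLp_le {n : ℕ} {f : (Fin n → ℝ) → ℝ} (hf : Differentiable ℝ f) {C : ℝ}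
    (hC : ∀ x : Fin n → ℝ, ∑ k : Fin n, (fderiv ℝ f x (Pi.single k 1)) ^ 2 ≤ C)
    (x : EuclideanSpace ℝ (Fin n)) :
    ‖fderiv ℝ (fun y : EuclideanSpace ℝ (Fin n) ↦ f (WithLp.ofLp y)) x‖ ≤ √C := by
  have hd : HasFDerivAt (fun y : EuclideanSpace ℝ (Fin n) ↦ f (WithLp.ofLp y))
      ((fderiv ℝ f (WithLp.ofLp x)).comp
        (EuclideanSpace.equiv (Fin n) ℝ : EuclideanSpace ℝ (Fin n) →L[ℝ] (Fin n → ℝ))) x :=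
    (hf (WithLp.ofLp x)).hasFDerivAt.comp x (EuclideanSpace.equiv (Fin n) ℝ).hasFDerivAt
  rw [hd.fderiv]
  refine ContinuousLinearMap.opNorm_le_bound _ (Real.sqrt_nonneg _) fun h ↦ ?_
  have hsum : fderiv ℝ f (WithLp.ofLp x) (WithLp.ofLp h)
      = ∑ k, fderiv ℝ f (WithLp.ofLp x) (Pi.single k 1) * h k := by
    conv_lhs => rw [pi_eq_sum_univ' (WithLp.ofLp h)]
    simp [map_sum, mul_comm, Pi.single]
  change ‖fderiv ℝ f (WithLp.ofLp x) (WithLp.ofLp h)‖ ≤ _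
  rw [hsum, EuclideanSpace.norm_eq, ← Real.sqrt_mul' _ (by positivity)]
  refine Real.abs_le_sqrt ((Finset.sum_mul_sq_le_sq_mul_sq _ _ _).trans ?_)
  simp only [Real.norm_eq_abs, sq_abs]
  exact mul_le_mul_of_nonneg_right (hC _) (by positivity)

/-- Gaussian `L²` concentration via quadratic interpolation: if `f : ℝⁿ → ℝ` is
differentiable with `Σ_k (∂f/∂x_k)² ≤ C` uniformly, and `U, V` are independent
standard Gaussian vectors in `ℝⁿ`, then `E[(f(U) - f(V))²] ≤ 2C`. -/
theorem gaussian_L2_concentration (n : ℕ) (f : (Fin n → ℝ) → ℝ)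
    (hf : Differentiable ℝ f) (C : ℝ)
    (hC : ∀ x : Fin n → ℝ, ∑ k : Fin n, (fderiv ℝ f x (Pi.single k 1)) ^ 2 ≤ C) :
    (∫ x : (Fin n → ℝ) × (Fin n → ℝ), (f x.1 - f x.2) ^ 2
        ∂((Measure.pi fun _ : Fin n => gaussianReal 0 1).prod
          (Measure.pi fun _ : Fin n => gaussianReal 0 1)))
      ≤ 2 * C := by
  have hC0 : 0 ≤ C := (Finset.sum_nonneg fun k _ ↦ sq_nonneg _).trans (hC 0)
  let g : EuclideanSpace ℝ (Fin n) → ℝ := fun y ↦ f (WithLp.ofLp y)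
  have hg : Differentiable ℝ g := hf.comp (EuclideanSpace.equiv (Fin n) ℝ).differentiable
  have hgc : Continuous g := hg.continuous
  have hgL := norm_fderiv_comp_ofLp_le hf hC
  have hmem : MemLp g 2 (stdGaussian (EuclideanSpace ℝ (Fin n))) := by
    simpa using memLp_comp_add_of_norm_fderiv_le hg hgL
      (IsGaussian.memLp_id (stdGaussian _) 2 (by norm_num)) 0
  have key := translateVariance_stdGaussian_le hg hgL 0
  simp only [translateVariance, zero_add, Real.sq_sqrt hC0] at key
  rw [← map_pi_eq_stdGaussian] at hmem key
  rw [integral_map (by fun_prop) (by fun_prop), integral_map (by fun_prop) (by fun_prop)] at key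
  have hf2 : MemLp f 2 (Measure.pi fun _ : Fin n ↦ gaussianReal 0 1) :=
    (memLp_map_measure_iff hmem.1 (by fun_prop)).1 hmem
  rw [integral_sub_sq_prod_self hf2]
  exact mul_le_mul_of_nonneg_left key zero_le_two
end
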